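/- Let K be an algebraically closed field of characteristic 0 and let R be an integral domain which is a smooth K-algebra of finite type. Let m be a maximal ideal of R and let h ∈ m be a nonzero element such that every minimal prime ideal of R containing h is contained in m. Let R̂ denote the m-adic completion of R, and let R̂[1/h] denote the localization of R̂ at the image of h. Then the natural map R[1/h]/R → R̂[1/h]/R̂ induced by R → R̂ is injective. -/

import Mathlib

universe u

section Aux
open scoped TensorProduct nonZeroDivisors

theorem aux_integral {R : Type*} [CommRing R] [IsDomain R] [IsNoetherianRing R]
    [IsIntegrallyClosed R] (I : Ideal R) (hI : I ≠ ⊥) (r H : R) (hH : H ≠ 0)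
    (hx : ∀ z ∈ I, ∃ w ∈ I, z * r = H * w) : H ∣ r := by
  have hH' : algebraMap R (FractionRing R) H ≠ 0 := by simpa using hH
  let x : FractionRing R := algebraMap R (FractionRing R) r / algebraMap R (FractionRing R) H
  have hint : IsIntegral R x := by
    refine isIntegral_of_smul_mem_submodule (M := FractionRing R)
      (Submodule.map (Algebra.linearMap R (FractionRing R)) I) ?_ ?_ x ?_
    · obtain ⟨z, hz, hz0⟩ := Submodule.exists_mem_ne_zero_of_ne_bot hI
      intro hb
      have : algebraMap R (FractionRing R) z ∈ Submodule.map (Algebra.linearMap R (FractionRing R)) I := ⟨z, hz, rfl⟩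
      rw [hb] at this
      exact hz0 (by simpa using this)
    · exact (IsNoetherian.noetherian I).map _
    · rintro _ ⟨z, hz, rfl⟩
      obtain ⟨w, hw, e⟩ := hx z hz
      refine ⟨w, hw, ?_⟩
      have e' := congrArg (algebraMap R (FractionRing R)) e
      simp only [map_mul] at e'
      simp only [Algebra.linearMap_apply, smul_eq_mul, x]
      field_simp
      linear_combination -e'
  obtain ⟨y, hy⟩ := IsIntegrallyClosed.algebraMap_eq_of_integral hint
  refine ⟨y, IsFractionRing.injective R (FractionRing R) ?_⟩
  rw [map_mul, hy]
  exact (mul_div_cancel₀ _ hH').symm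

theorem aux_minimal {R : Type*} [CommRing R] [IsDomain R] [IsNoetherianRing R]
    [IsIntegrallyClosed R] (p : Ideal R) [p.IsPrime] (r h H : R) (hh : h ≠ 0) (hH : H ≠ 0)
    (hp : ∀ z, z ∈ p ↔ H ∣ z * r) (hhp : h ∈ p) : p ∈ (Ideal.span {h}).minimalPrimes := by
  have hr : ¬ H ∣ r := fun hd ↦ (Ideal.ne_top_iff_one p).1 ‹p.IsPrime›.ne_top
    ((hp 1).2 (by simpa using hd))
  have hbot : ∀ q : Ideal R, h ∈ q → q ≠ ⊥ := by
    rintro q hq rfl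
    exact hh (by simpa using hq)
  obtain ⟨y, hy, c, hc, e⟩ : ∃ y ∈ p, ∃ c ∉ p, y * r = H * c := by
    by_contra! hcon
    refine hr (aux_integral p (hbot p hhp) r H hH fun z hz ↦ ?_)
    obtain ⟨w, hw⟩ := (hp z).1 hz
    exact ⟨w, by_contra fun hw' ↦ hcon z hz w hw' hw, hw⟩
  refine ⟨⟨‹_›, by simpa [Ideal.span_le] using hhp⟩, ?_⟩
  rintro q ⟨hq, hhq⟩ hqp
  have hhq : h ∈ q := by simpa [Ideal.span_le] using hhq
  -- z * c = y * w when z * r = H * w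
  have key : ∀ z w, z * r = H * w → z * c = y * w := fun z w hw ↦
    mul_left_cancel₀ hH (by linear_combination y * hw - z * e)
  by_cases hyq : y ∈ q
  · intro z hz
    obtain ⟨w, hw⟩ := (hp z).1 hz
    refine (hq.mem_or_mem (x := z) (y := c) ?_).resolve_right fun h ↦ hc (hqp h)
    rw [key z w hw]
    exact q.mul_mem_right _ hyq
  · refine (hr (aux_integral q (hbot q hhq) r H hH fun z hz ↦ ?_)).elim
    obtain ⟨w, hw⟩ := (hp z).1 (hqp hz)
    refine ⟨w, (hq.mem_or_mem (x := y) (y := w) ?_).resolve_left hyq, hw⟩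
    rw [← key z w hw]
    exact q.mul_mem_right _ hz

theorem aux_dvd {R : Type*} [CommRing R] [IsDomain R] [IsNoetherianRing R]
    [IsIntegrallyClosed R] (m : Ideal R) (h : R) (hh0 : h ≠ 0)
    (hmin : ∀ p ∈ (Ideal.span ({h} : Set R)).minimalPrimes, p ≤ m) (n : ℕ) (g r : R)
    (hg : g ∉ m) (hd : h ^ n ∣ g * r) : h ^ n ∣ r := by
  by_contra hr
  have hr' : (Ideal.Quotient.mk (Ideal.span {h ^ n}) r) ≠ 0 := by
    rwa [Ne, Ideal.Quotient.eq_zero_iff_mem, Ideal.mem_span_singleton]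
  obtain ⟨p, hp, hle⟩ := exists_le_isAssociatedPrime_of_isNoetherianRing R _ hr'
  rw [isAssociatedPrime_iff] at hp
  obtain ⟨hpp, s, hs⟩ := hp
  obtain ⟨s, rfl⟩ := Ideal.Quotient.mk_surjective s
  have mem : ∀ t z : R, z ∈ (⊥ : Submodule R (R ⧸ Ideal.span {h ^ n})).colon
      {Ideal.Quotient.mk (Ideal.span {h ^ n}) t} ↔ h ^ n ∣ z * t := by
    intro t z
    rw [Submodule.mem_colon_singleton, Submodule.mem_bot, ← Ideal.mem_span_singleton,
      ← Ideal.Quotient.eq_zero_iff_mem, map_mul]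
    rfl
  have hgp : g ∈ p := hle ((mem _ _).2 hd)
  have hp' : ∀ z, z ∈ p ↔ h ^ n ∣ z * s := fun z ↦ by rw [hs, mem]
  exact hg (hmin p (aux_minimal p s h (h ^ n) hh0 (pow_ne_zero _ hh0) hp'
    (hpp.mem_of_pow_mem n ((hp' _).2 (dvd_mul_right _ _)))) hgp)

theorem aux_etale {P S : Type*} [CommRing P] [IsDomain P] [IsIntegrallyClosed P]
    [CommRing S] [IsDomain S] [Algebra P S] [Algebra.Etale P S] : IsIntegrallyClosed S := by
  let F := FractionRing P
  let T := S ⊗[P] F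
  have hflat : Module.Flat P S := inferInstance
  have hinj : Function.Injective (algebraMap P S) := FaithfulSMul.algebraMap_injective P S
  have hle : Algebra.algebraMapSubmonoid S P⁰ ≤ S⁰ := by
    rintro _ ⟨a, ha, rfl⟩
    exact mem_nonZeroDivisors_of_ne_zero
      ((map_ne_zero_iff _ hinj).2 (nonZeroDivisors.ne_zero ha))
  have hloc : IsLocalization (Algebra.algebraMapSubmonoid S P⁰) T := inferInstance
  have hdom : IsDomain T := IsLocalization.isDomain_of_le_nonZeroDivisors _ hle
  have : Algebra.Etale F (F ⊗[P] S) := inferInstance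
  have hfin : Module.Finite F (F ⊗[P] S) := Algebra.FormallyUnramified.finite_of_free F _
  let e : F ⊗[P] S ≃+* T := (Algebra.TensorProduct.comm P F S).toRingEquiv
  have : IsDomain (F ⊗[P] S) := e.toMulEquiv.isDomain _
  have hfield : IsField T := e.toMulEquiv.symm.isField
    (isField_of_isIntegral_of_isField' (R := F) (Field.toIsField F))
  let := hfield.toField
  have hfr : IsFractionRing S T := by
    refine IsFractionRing.of_field S T fun z ↦ ?_
    obtain ⟨⟨a, b⟩, hab⟩ := IsLocalization.surj (Algebra.algebraMapSubmonoid S P⁰) z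
    refine ⟨a, b, ?_⟩
    have hb : algebraMap S T b ≠ 0 :=
      (IsLocalization.map_units T b).ne_zero
    exact eq_div_of_mul_eq hb hab
  rw [isIntegrallyClosed_iff T]
  intro x hx
  obtain ⟨y, hy⟩ := (TensorProduct.toIntegralClosure_bijective_of_smooth (R := P) (S := S)
    (B := F)).2 ⟨x, hx⟩
  replace hy := congrArg Subtype.val hy
  simp only at hy
  rw [← hy]
  clear hy hx
  clear x
  induction y with
  | zero => exact ⟨0, by simp⟩
  | add a b ha hb =>
    obtain ⟨a', ha⟩ := ha
    obtain ⟨b', hb⟩ := hb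
    exact ⟨a' + b', by rw [map_add, map_add, ha, hb]; rfl⟩
  | tmul s b =>
    obtain ⟨c, hc⟩ := IsIntegrallyClosed.algebraMap_eq_of_integral b.2
    refine ⟨c • s, ?_⟩
    change (c • s) ⊗ₜ[P] (1 : F) = s ⊗ₜ b.1
    rw [← hc, TensorProduct.smul_tmul, Algebra.smul_def, mul_one]

theorem aux_normal (K : Type*) [Field K] (R : Type*) [CommRing R] [IsDomain R] [Algebra K R]
    [Algebra.Smooth K R] : IsIntegrallyClosed R := by
  refine IsIntegrallyClosed.of_localization_maximal fun p _ _ ↦ ?_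
  obtain ⟨f, hfm, n, _, _, _⟩ :=
      Algebra.IsSmoothAt.exists_isStandardEtale_mvPolynomial (R := K) (p := p)
  have hle : Submonoid.powers f ≤ p.primeCompl := Submonoid.powers_le.2 hfm
  have hle' : Submonoid.powers f ≤ R⁰ := hle.trans p.primeCompl_le_nonZeroDivisors
  have : IsDomain (Localization.Away f) := IsLocalization.isDomain_of_le_nonZeroDivisors _ hle'
  have : IsIntegrallyClosed (Localization.Away f) := aux_etale (P := MvPolynomial (Fin n) K)
  let := IsLocalization.localizationAlgebraOfSubmonoidLe (Localization.Away f)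
    (Localization.AtPrime p) _ _ hle
  have := IsLocalization.localization_isScalarTower_of_submonoid_le (Localization.Away f)
    (Localization.AtPrime p) _ _ hle
  have := IsLocalization.isLocalization_of_submonoid_le (Localization.Away f)
    (Localization.AtPrime p) _ _ hle
  refine isIntegrallyClosed_of_isLocalization _ (p.primeCompl.map (algebraMap R (Localization.Away f))) ?_
  rintro _ ⟨a, ha, rfl⟩
  refine mem_nonZeroDivisors_of_ne_zero ?_
  exact (map_ne_zero_iff _ (IsLocalization.injective _ hle')).2 fun h0 ↦ ha (h0 ▸ p.zero_mem)

theorem aux_krull {R : Type*} [CommRing R] [IsNoetherianRing R] (m : Ideal R)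
    [m.IsMaximal] (r H : R) (s : AdicCompletion m R)
    (hs : algebraMap R (AdicCompletion m R) r = algebraMap R (AdicCompletion m R) H * s) :
    ∃ g ∉ m, H ∣ g * r := by
  have hmem : Ideal.Quotient.mk (Ideal.span {H}) r ∈
      (⨅ i : ℕ, m ^ i • ⊤ : Submodule R (R ⧸ Ideal.span {H})) := by
    rw [Submodule.mem_iInf]
    intro i
    obtain ⟨t, ht⟩ := Ideal.Quotient.mk_surjective (AdicCompletion.evalₐ m i s)
    have h1 := congrArg (AdicCompletion.evalₐ m i) hs
    rw [map_mul, ← ht, AlgHom.commutes, AlgHom.commutes] at h1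
    have h2 : r - H * t ∈ m ^ i := by
      rw [← Ideal.Quotient.eq, map_mul]; exact h1
    have h3 : Ideal.Quotient.mk (Ideal.span {H}) r = (r - H * t) • (1 : R ⧸ Ideal.span {H}) := by
      rw [Algebra.smul_def, mul_one]
      refine (Ideal.Quotient.eq.2 ?_)
      rw [Ideal.mem_span_singleton]
      exact ⟨t, by ring⟩
    rw [h3]
    exact Submodule.smul_mem_smul h2 trivial
  obtain ⟨u, hu⟩ := (Ideal.mem_iInf_smul_pow_eq_bot_iff m _).1 hmem
  refine ⟨1 - u, fun h1 ↦ ?_, ?_⟩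
  · refine (Ideal.ne_top_iff_one m).1 (Ideal.IsMaximal.ne_top ‹_›) ?_
    simpa using m.add_mem h1 u.2
  · rw [← Ideal.mem_span_singleton, ← Ideal.Quotient.eq_zero_iff_mem, sub_mul, one_mul, map_sub,
      sub_eq_zero]
    exact hu.symm

end Aux

/-- Let `K` be an algebraically closed field of characteristic `0` and `R` an integral
domain which is a smooth `K`-algebra of finite type.  Let `m` be a maximal ideal of `R` and
`h ∈ m` a nonzero element such that every minimal prime over `(h)` is contained in `m`
(i.e. every irreducible component of the hypersurface `{h = 0}` passes through the closed
point corresponding to `m`).  Then the natural map `R[1/h]/R → R̂[1/h]/R̂`, where `R̂` is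
the `m`-adic completion, is injective: an element of `R[1/h]` whose image in `R̂[1/h]` lies
in `R̂` already lies in `R`. -/
theorem polar_parts_injective_into_completion
    (K : Type u) [Field K] [CharZero K] [IsAlgClosed K]
    (R : Type u) [CommRing R] [IsDomain R] [Algebra K R]
    [Algebra.FiniteType K R] [Algebra.Smooth K R]
    (m : Ideal R) [m.IsMaximal] (h : R) (hh0 : h ≠ 0) (hhm : h ∈ m)
    (hmin : ∀ p ∈ (Ideal.span ({h} : Set R)).minimalPrimes, p ≤ m) :
    ∀ a : Localization.Away h,
      Localization.awayMap (algebraMap R (AdicCompletion m R)) h a ∈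
        Set.range (algebraMap (AdicCompletion m R)
          (Localization.Away (algebraMap R (AdicCompletion m R) h))) →
      a ∈ Set.range (algebraMap R (Localization.Away h)) := by
  have : IsNoetherianRing R := Algebra.FiniteType.isNoetherianRing K R
  have : IsIntegrallyClosed R := aux_normal K R
  rintro a ⟨s, hs⟩
  obtain ⟨n, r, hr⟩ := IsLocalization.Away.surj h a
  have h1 := congrArg (Localization.awayMap (algebraMap R (AdicCompletion m R)) h) hr
  have hmap : ∀ t, Localization.awayMap (algebraMap R (AdicCompletion m R)) h
      (algebraMap R _ t) = algebraMap _ _ (algebraMap R (AdicCompletion m R) t) := fun t ↦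
    IsLocalization.map_eq _ t
  rw [map_mul, ← hs, map_pow, hmap, hmap, ← map_pow, ← map_mul] at h1
  obtain ⟨k, hk⟩ := IsLocalization.Away.exists_of_eq (algebraMap R (AdicCompletion m R) h) h1
  obtain ⟨g, hg, hd⟩ := aux_krull m (h ^ k * r) (h ^ (k + n)) s (by
    rw [map_mul, map_pow, map_pow, ← hk]; ring)
  have hd' : h ^ n ∣ g * r := by
    obtain ⟨w, hw⟩ := hd
    exact ⟨w, mul_left_cancel₀ (pow_ne_zero k hh0) (by linear_combination hw)⟩
  obtain ⟨w, rfl⟩ := aux_dvd m h hh0 hmin n g r hg hd'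
  refine ⟨w, ?_⟩
  have hu : IsUnit (algebraMap R (Localization.Away h) h ^ n) :=
    (IsLocalization.Away.algebraMap_isUnit h).pow n
  refine hu.mul_right_cancel ?_
  rw [hr, map_mul, map_pow, mul_comm]
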